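/- Flat model of the paper's Uniqueness Theorem for a signature-changing plane: work on ℝ × ℝ with coordinates (t,x), Lorentzian region L = {t < 0}, degeneracy line Σ = {t = 0}, Euclidean region E = {t > 0}. Let u, v : ℝ × ℝ → ℂ be continuously differentiable on all of ℝ², twice continuously differentiable on L and on E, satisfy the wave equation ∂²w/∂t² = ∂²w/∂x² on L and Laplace's equation ∂²w/∂t² + ∂²w/∂x² = 0 on E (for w = u and w = v), and suppose that on E each of u, v can be written as f(z) + conj(g(z)) with z = x + it, where f, g are holomorphic on the upper half-plane and f, g, f′, g′ extend continuously to its closure. Let a < b with b − a > 2, so that the domain of null dependence of the segment C = {−1} × [a,b] meets Σ in the nontrivial interval [a+1, b−1]. If u(−1,x) = v(−1,x) and (∂u/∂t)(−1,x) = (∂v/∂t)(−1,x) for all x ∈ [a,b], then u = v on all of ℝ × ℝ. -/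

import Mathlib

open Set

/-- A global solution of the signature-changing field equation on the plane, in the flat
model: `w` is `C¹` on all of `ℝ²`, `C²` on the Lorentzian region `L = {t < 0}` and on
the Euclidean region `E = {t > 0}`, satisfies the wave equation `∂²w/∂t² = ∂²w/∂x²` on
`L` and Laplace's equation `∂²w/∂t² + ∂²w/∂x² = 0` on `E`, and on `E` is of the form
`f(z) + conj (g z)` with `z = x + i t`, where `f, g` are holomorphic on the open upper
half-plane and `f, g, f′, g′` extend continuously to the closed upper half-plane. -/
def IsGlobalSignatureChangeSolution (w : ℝ × ℝ → ℂ) : Prop :=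
  ContDiff ℝ 1 w ∧
  ContDiffOn ℝ 2 w {p : ℝ × ℝ | p.1 < 0} ∧
  ContDiffOn ℝ 2 w {p : ℝ × ℝ | 0 < p.1} ∧
  (∀ p : ℝ × ℝ, p.1 < 0 →
    fderiv ℝ (fun q : ℝ × ℝ => fderiv ℝ w q (1, 0)) p (1, 0) =
    fderiv ℝ (fun q : ℝ × ℝ => fderiv ℝ w q (0, 1)) p (0, 1)) ∧
  (∀ p : ℝ × ℝ, 0 < p.1 →
    fderiv ℝ (fun q : ℝ × ℝ => fderiv ℝ w q (1, 0)) p (1, 0) +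
    fderiv ℝ (fun q : ℝ × ℝ => fderiv ℝ w q (0, 1)) p (0, 1) = 0) ∧
  ∃ f g : ℂ → ℂ,
    DifferentiableOn ℂ f {z : ℂ | 0 < z.im} ∧
    DifferentiableOn ℂ g {z : ℂ | 0 < z.im} ∧
    ContinuousOn f {z : ℂ | 0 ≤ z.im} ∧
    ContinuousOn g {z : ℂ | 0 ≤ z.im} ∧
    ContinuousOn (deriv f) {z : ℂ | 0 ≤ z.im} ∧
    ContinuousOn (deriv g) {z : ℂ | 0 ≤ z.im} ∧
    ∀ p : ℝ × ℝ, 0 < p.1 →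
      w p = f (↑p.2 + ↑p.1 * Complex.I) +
        starRingEnd ℂ (g (↑p.2 + ↑p.1 * Complex.I))

/-- The first order combination `w_t + σ w_x` is constant along the null lines
`x + σ t = y` of the Lorentzian region, up to the line `t = 0`. -/
lemma IsGlobalSignatureChangeSolution.fderiv_null_const {w : ℝ × ℝ → ℂ}
    (hw : IsGlobalSignatureChangeSolution w) {σ : ℝ} (hσ : σ * σ = 1) (y : ℝ) {t : ℝ}
    (ht : t ≤ 0) :
    fderiv ℝ w (t, y - σ * t) (1, σ) = fderiv ℝ w (0, y) (1, σ) := by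
  obtain ⟨hC1, hC2, -, hwave, -⟩ := hw
  have hcont : Continuous (fderiv ℝ w) := hC1.continuous_fderiv one_ne_zero
  suffices hder : ∀ s < 0, HasDerivAt (fun s : ℝ => fderiv ℝ w (s, y - σ * s) (1, σ)) 0 s by
    have hφ : ContinuousOn (fun s : ℝ => fderiv ℝ w (s, y - σ * s) (1, σ)) (Icc t 0) :=
      Continuous.continuousOn (by fun_prop)
    have := constant_of_has_deriv_right_zero hφ
      (fun s hs => (hder s hs.2).hasDerivWithinAt) 0 (right_mem_Icc.2 ht)
    simpa only [mul_zero, sub_zero] using this.symm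
  intro s hs0
  have hopen : IsOpen {p : ℝ × ℝ | p.1 < 0} := isOpen_lt continuous_fst continuous_const
  have hat : ContDiffAt ℝ 2 w (s, y - σ * s) := hC2.contDiffAt (hopen.mem_nhds hs0)
  have hd : DifferentiableAt ℝ (fderiv ℝ w) (s, y - σ * s) :=
    (hat.fderiv_right (m := 1) (by norm_num)).differentiableAt (by norm_num)
  have hsymm : IsSymmSndFDerivAt ℝ w (s, y - σ * s) :=
    hat.isSymmSndFDerivAt (by simp)
  have happ (e : ℝ × ℝ) : fderiv ℝ (fun q => fderiv ℝ w q e) (s, y - σ * s) e =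
      fderiv ℝ (fderiv ℝ w) (s, y - σ * s) e e := by
    have := (hd.hasFDerivAt.clm_apply (hasFDerivAt_const e _)).fderiv
    rw [this]; simp
  have hw2 := hwave (s, y - σ * s) hs0
  rw [happ, happ] at hw2
  have hγ : HasDerivAt (fun s : ℝ => (s, y - σ * s)) ((1 : ℝ), -σ) s := by
    have h1 : HasDerivAt (fun s : ℝ => y - σ * s) (-σ) s := by
      simpa using ((hasDerivAt_id s).const_mul σ).const_sub y
    exact (hasDerivAt_id s).prodMk h1
  have hline : HasDerivAt (fun s : ℝ => fderiv ℝ w (s, y - σ * s))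
      (fderiv ℝ (fderiv ℝ w) (s, y - σ * s) (1, -σ)) s :=
    HasFDerivAt.comp_hasDerivAt (f := fun s : ℝ => (s, y - σ * s)) s hd.hasFDerivAt hγ
  have hcomp : HasDerivAt (fun s : ℝ => fderiv ℝ w (s, y - σ * s) (1, σ))
      (fderiv ℝ (fderiv ℝ w) (s, y - σ * s) (1, -σ) (1, σ)) s :=
    (ContinuousLinearMap.apply ℝ ℂ ((1 : ℝ), σ)).hasFDerivAt.comp_hasDerivAt s hline
  refine hcomp.congr_deriv ?_
  have e1 : ((1 : ℝ), σ) = (1, 0) + σ • (0, 1) := by simp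
  have e2 : ((1 : ℝ), -σ) = (1, 0) - σ • (0, 1) := by simp
  rw [e1, e2]
  simp only [map_add, map_sub, map_smul, sub_apply, smul_apply]
  rw [hw2, hsymm.eq (1, 0) (0, 1), smul_sub, smul_smul, hσ]
  simp

/-- A function holomorphic on the upper half-plane whose boundary values vanish on a
real interval is zero. -/
lemma Complex.eq_zero_of_boundary_eq_zero {h : ℂ → ℂ}
    (hc : ContinuousOn h {z : ℂ | 0 ≤ z.im}) (hd : DifferentiableOn ℂ h {z : ℂ | 0 < z.im})
    {α β : ℝ} (hαβ : α < β) (h0 : ∀ x ∈ Ioo α β, h (x : ℝ) = 0) {z : ℂ} (hz : 0 < z.im) :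
    h z = 0 := by
  have hopen : IsOpen {z : ℂ | 0 < z.im} := isOpen_lt continuous_const Complex.continuous_im
  -- Multiply the four rotations of `h` about `p` on the square centred at `p` with one
  -- side on the real line: the product vanishes on the boundary, hence at the centre.
  have near (p : ℂ) (hp : 0 < p.im) (hα : α < p.re - p.im) (hβ : p.re + p.im < β) :
      h p = 0 := by
    set ε := p.im with hε
    set U : Set ℂ := Ioo (-ε) ε ×ℂ Ioo (-ε) ε with hU
    have hcl : closure U = Icc (-ε) ε ×ℂ Icc (-ε) ε := by
      rw [hU, Complex.closure_reProdIm, closure_Ioo (by linarith)]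
    have hUo : IsOpen U := isOpen_Ioo.reProdIm isOpen_Ioo
    have hUb : Bornology.IsBounded U :=
      (Metric.isBounded_Ioo (-ε) ε).reProdIm (Metric.isBounded_Ioo (-ε) ε)
    let P : ℂ → ℂ := fun ζ =>
      h (p + ζ) * h (p + Complex.I * ζ) * h (p - ζ) * h (p - Complex.I * ζ)
    have hP : DiffContOnCl ℂ P U := by
      constructor
      · intro ζ hζ
        simp only [hU, Complex.mem_reProdIm, mem_Ioo] at hζ
        obtain ⟨⟨h1, h2⟩, h3, h4⟩ := hζ
        have dh (q : ℂ) (hq : 0 < q.im) : DifferentiableAt ℂ h q :=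
          hd.differentiableAt (hopen.mem_nhds hq)
        have d1 : DifferentiableAt ℂ (fun ζ => h (p + ζ)) ζ :=
          (dh _ (by simp; linarith)).comp ζ (f := fun ζ => p + ζ) (by fun_prop)
        have d2 : DifferentiableAt ℂ (fun ζ => h (p + Complex.I * ζ)) ζ :=
          (dh _ (by simp; linarith)).comp ζ (f := fun ζ => p + Complex.I * ζ) (by fun_prop)
        have d3 : DifferentiableAt ℂ (fun ζ => h (p - ζ)) ζ :=
          (dh _ (by simp; linarith)).comp ζ (f := fun ζ => p - ζ) (by fun_prop)
        have d4 : DifferentiableAt ℂ (fun ζ => h (p - Complex.I * ζ)) ζ :=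
          (dh _ (by simp; linarith)).comp ζ (f := fun ζ => p - Complex.I * ζ) (by fun_prop)
        exact (((d1.mul d2).mul d3).mul d4).differentiableWithinAt
      · rw [hcl]
        refine ((ContinuousOn.mul ?_ ?_).mul ?_).mul ?_ <;>
        · refine hc.comp (by fun_prop) fun ζ hζ => ?_
          simp only [Complex.mem_reProdIm, mem_Icc] at hζ
          obtain ⟨⟨h1, h2⟩, h3, h4⟩ := hζ
          simp
          linarith
    have hfr : ∀ ζ ∈ frontier U, ‖P ζ‖ ≤ 0 := by
      intro ζ hζ
      rw [hUo.frontier_eq, hcl] at hζ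
      simp only [hU, mem_sdiff, Complex.mem_reProdIm, mem_Icc, mem_Ioo] at hζ
      obtain ⟨⟨⟨h1, h2⟩, h3, h4⟩, hn⟩ := hζ
      have real (q : ℂ) (hq : q.im = 0) (hq1 : α < q.re) (hq2 : q.re < β) : h q = 0 := by
        have : q = (q.re : ℂ) := Complex.ext (by simp) (by simp [hq])
        rw [this]
        exact h0 _ ⟨hq1, hq2⟩
      rw [norm_le_zero_iff]
      rcases h1.eq_or_lt with e | l1
      · have := real (p + Complex.I * ζ) (by simp; linarith) (by simp; linarith)
          (by simp; linarith)
        simp [P, this]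
      rcases h2.eq_or_lt with e | l2
      · have := real (p - Complex.I * ζ) (by simp; linarith) (by simp; linarith)
          (by simp; linarith)
        simp [P, this]
      rcases h3.eq_or_lt with e | l3
      · have := real (p + ζ) (by simp; linarith) (by simp; linarith) (by simp; linarith)
        simp [P, this]
      rcases h4.eq_or_lt with e | l4
      · have := real (p - ζ) (by simp; linarith) (by simp; linarith) (by simp; linarith)
        simp [P, this]
      exact absurd ⟨⟨l1, l2⟩, l3, l4⟩ hn
    have h00 : (0 : ℂ) ∈ closure U := by
      rw [hcl]
      simp [Complex.mem_reProdIm, hp.le]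
    have := Complex.norm_le_of_forall_mem_frontier_norm_le hUb hP hfr h00
    simpa only [P, add_zero, sub_zero, mul_zero, norm_le_zero_iff, mul_self_eq_zero, mul_eq_zero,
      or_self] using this
  have han : AnalyticOnNhd ℂ h {z : ℂ | 0 < z.im} := hd.analyticOnNhd hopen
  have hpre : IsPreconnected {z : ℂ | 0 < z.im} :=
    (convex_halfSpace_im_gt 0).isPreconnected
  let p₀ : ℂ := ⟨(α + β) / 2, (β - α) / 4⟩
  have hp₀ : p₀ ∈ {z : ℂ | 0 < z.im} := by
    simp only [mem_ofPred_eq, p₀]; linarith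
  refine han.eqOn_zero_of_preconnected_of_eventuallyEq_zero hpre hp₀ ?_ hz
  have c1 : ∀ᶠ q : ℂ in nhds p₀, α < q.re - q.im :=
    (isOpen_lt continuous_const (by fun_prop)).mem_nhds (by simp [p₀]; linarith)
  have c2 : ∀ᶠ q : ℂ in nhds p₀, q.re + q.im < β :=
    (isOpen_lt (by fun_prop) continuous_const).mem_nhds (by simp [p₀]; linarith)
  filter_upwards [hopen.mem_nhds hp₀, c1, c2] with q hq hq1 hq2 using near q hq hq1 hq2

/-- On the Euclidean region, the Wirtinger derivatives of a solution (the second one up to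
conjugation) are holomorphic functions of `z = x + i t`. -/
lemma IsGlobalSignatureChangeSolution.differentiableOn_wirtinger {w : ℝ × ℝ → ℂ}
    (hw : IsGlobalSignatureChangeSolution w) :
    DifferentiableOn ℂ (fun z : ℂ => fderiv ℝ w (z.im, z.re) (0, 1) -
      Complex.I * fderiv ℝ w (z.im, z.re) (1, 0)) {z : ℂ | 0 < z.im} ∧
    DifferentiableOn ℂ (fun z : ℂ => starRingEnd ℂ (fderiv ℝ w (z.im, z.re) (0, 1) +
      Complex.I * fderiv ℝ w (z.im, z.re) (1, 0))) {z : ℂ | 0 < z.im} := by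
  obtain ⟨-, -, -, -, -, f, g, hf, hg, -, -, -, -, hfg⟩ := hw
  have hopen : IsOpen {z : ℂ | 0 < z.im} := isOpen_lt continuous_const Complex.continuous_im
  have hopen' : IsOpen {p : ℝ × ℝ | 0 < p.1} := isOpen_lt continuous_const continuous_fst
  have key (z : ℂ) (hz : 0 < z.im) (e : ℝ × ℝ) : fderiv ℝ w (z.im, z.re) e =
      (e.2 + e.1 * Complex.I) * deriv f z +
        starRingEnd ℂ ((e.2 + e.1 * Complex.I) * deriv g z) := by
    let Z : ℝ × ℝ →L[ℝ] ℂ := Complex.ofRealCLM.comp (ContinuousLinearMap.snd ℝ ℝ ℝ) +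
      Complex.I • Complex.ofRealCLM.comp (ContinuousLinearMap.fst ℝ ℝ ℝ)
    have hZ (q : ℝ × ℝ) : Z q = q.2 + q.1 * Complex.I := by simp [Z, mul_comm]
    have hZz : Z (z.im, z.re) = z := by rw [hZ]; exact Complex.re_add_im z
    have hcomp {k : ℂ → ℂ} (hk : DifferentiableOn ℂ k {z : ℂ | 0 < z.im}) :
        HasFDerivAt (fun q => k (Z q))
          ((ContinuousLinearMap.toSpanSingleton ℂ (deriv k z)).restrictScalars ℝ ∘L Z) (z.im, z.re) := by
      have h1 : HasFDerivAt k (ContinuousLinearMap.toSpanSingleton ℂ (deriv k z))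
          (Z (z.im, z.re)) := by
        rw [hZz]
        exact (hk.differentiableAt (hopen.mem_nhds hz)).hasDerivAt.hasFDerivAt
      exact (h1.restrictScalars ℝ).comp _ Z.hasFDerivAt
    have hsum := (hcomp hf).add
      ((Complex.conjCLE.toContinuousLinearMap.hasFDerivAt).comp (z.im, z.re) (hcomp hg))
    have heq : w =ᶠ[nhds (z.im, z.re)]
        (fun q => f (Z q)) + (Complex.conjCLE.toContinuousLinearMap ∘ fun q => g (Z q)) := by
      filter_upwards [hopen'.mem_nhds hz] with q hq
      simp [hfg q hq, hZ]
    rw [(hsum.congr_of_eventuallyEq heq).fderiv]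
    simp [hZ, mul_comm]
  constructor
  · refine ((hf.deriv hopen).const_mul 2).congr fun z hz => ?_
    rw [key z hz, key z hz]
    simp only [Complex.ofReal_one, Complex.ofReal_zero, map_mul, map_add, Complex.conj_I, map_one,
      map_zero]
    linear_combination (-deriv f z + starRingEnd ℂ (deriv g z)) * Complex.I_mul_I
  · refine ((hg.deriv hopen).const_mul 2).congr fun z hz => ?_
    rw [key z hz, key z hz]
    simp only [Complex.ofReal_one, Complex.ofReal_zero, map_mul, map_add, Complex.conj_I, map_one,
      map_zero, map_neg, Complex.conj_conj]
    linear_combination (starRingEnd ℂ (deriv f z) - deriv g z) * Complex.I_mul_I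

/-- Flat model of the paper's Uniqueness Theorem: two global solutions of the
signature-changing field equation on the plane whose Cauchy data (value and normal
derivative) agree on the spacelike segment `C = {−1} × [a,b]`, with `b − a > 2` so that
the domain of null dependence of `C` meets the degeneracy line `t = 0` in the
nontrivial interval `[a+1, b−1]`, agree everywhere. -/
theorem flat_signature_change_uniqueness
    (u v : ℝ × ℝ → ℂ)
    (hu : IsGlobalSignatureChangeSolution u)
    (hv : IsGlobalSignatureChangeSolution v)
    (a b : ℝ) (hab : a < b) (hgap : 2 < b - a)
    (hdata : ∀ x ∈ Icc a b, u (-1, x) = v (-1, x))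
    (hdata' : ∀ x ∈ Icc a b,
      fderiv ℝ u (-1, x) (1, 0) = fderiv ℝ v (-1, x) (1, 0)) :
    u = v := by
  have hCu : Continuous (fderiv ℝ u) := hu.1.continuous_fderiv one_ne_zero
  have hCv : Continuous (fderiv ℝ v) := hv.1.continuous_fderiv one_ne_zero
  have hdu : Differentiable ℝ u := hu.1.differentiable one_ne_zero
  have hdv : Differentiable ℝ v := hv.1.differentiable one_ne_zero
  have decomp (L : ℝ × ℝ →L[ℝ] ℂ) (σ : ℝ) : L (1, σ) = L (1, 0) + (σ : ℂ) * L (0, 1) := by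
    have e : ((1 : ℝ), σ) = (1, 0) + σ • (0, 1) := by simp
    rw [e, map_add, map_smul, Complex.real_smul]
  have ext_null {L M : ℝ × ℝ →L[ℝ] ℂ} (h1 : L (1, 1) = M (1, 1))
      (h2 : L (1, -1) = M (1, -1)) : L = M := by
    rw [decomp, decomp M] at h1 h2
    push_cast at h1 h2
    refine ContinuousLinearMap.ext fun q => ?_
    have e : q = q.1 • ((1 : ℝ), (0 : ℝ)) + q.2 • ((0 : ℝ), (1 : ℝ)) := by simp
    have ht : L (1, 0) = M (1, 0) := by linear_combination (h1 + h2) / 2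
    have hx : L (0, 1) = M (0, 1) := by linear_combination (h1 - h2) / 2
    rw [e]
    simp only [map_add, map_smul, ht, hx]
  have hdata_x (x : ℝ) (hx : x ∈ Ioo a b) :
      fderiv ℝ u (-1, x) (0, 1) = fderiv ℝ v (-1, x) (0, 1) := by
    have hγ : HasDerivAt (fun s : ℝ => ((-1 : ℝ), s)) ((0 : ℝ), (1 : ℝ)) x :=
      (hasDerivAt_const x (-1 : ℝ)).prodMk (hasDerivAt_id x)
    have h1 := (hdu (-1, x)).hasFDerivAt.comp_hasDerivAt x hγ
    have h2 := (hdv (-1, x)).hasFDerivAt.comp_hasDerivAt x hγ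
    refine (h1.congr_of_eventuallyEq ?_).unique h2
    filter_upwards [isOpen_Ioo.mem_nhds hx] with s hs
    exact (hdata s (Ioo_subset_Icc_self hs)).symm
  have hseg (x : ℝ) (hx : x ∈ Ioo a b) (σ : ℝ) :
      fderiv ℝ u (-1, x) (1, σ) = fderiv ℝ v (-1, x) (1, σ) := by
    rw [decomp, decomp (fderiv ℝ v _), hdata' x (Ioo_subset_Icc_self hx), hdata_x x hx]
  have hline (x : ℝ) (hx : x ∈ Ioo (a + 1) (b - 1)) :
      fderiv ℝ u (0, x) = fderiv ℝ v (0, x) := by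
    have step (σ : ℝ) (hσ : σ * σ = 1) (hmem : x - σ * (-1) ∈ Ioo a b) :
        fderiv ℝ u (0, x) (1, σ) = fderiv ℝ v (0, x) (1, σ) := by
      rw [← hu.fderiv_null_const hσ x (t := -1) (by norm_num),
        ← hv.fderiv_null_const hσ x (t := -1) (by norm_num), hseg _ hmem]
    exact ext_null
      (step 1 (by norm_num) ⟨by linarith [hx.1], by linarith [hx.2]⟩)
      (step (-1) (by norm_num) ⟨by linarith [hx.1], by linarith [hx.2]⟩)
  have hE (z : ℂ) (hz : 0 < z.im) :
      fderiv ℝ u (z.im, z.re) = fderiv ℝ v (z.im, z.re) := by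
    have hlt : a + 1 < b - 1 := by linarith
    have A := Complex.eq_zero_of_boundary_eq_zero (Continuous.continuousOn (by fun_prop))
      (hu.differentiableOn_wirtinger.1.sub hv.differentiableOn_wirtinger.1) hlt
      (fun x hx => by simp [hline x hx]) hz
    have B := Complex.eq_zero_of_boundary_eq_zero (Continuous.continuousOn (by fun_prop))
      (hu.differentiableOn_wirtinger.2.sub hv.differentiableOn_wirtinger.2) hlt
      (fun x hx => by simp [hline x hx]) hz
    simp only [Pi.sub_apply] at A B
    rw [← map_sub, map_eq_zero] at B
    have hx : fderiv ℝ u (z.im, z.re) (0, 1) = fderiv ℝ v (z.im, z.re) (0, 1) := by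
      linear_combination (A + B) / 2
    have ht : fderiv ℝ u (z.im, z.re) (1, 0) = fderiv ℝ v (z.im, z.re) (1, 0) := by
      refine mul_left_cancel₀ Complex.I_ne_zero ?_
      linear_combination (B - A) / 2
    exact ext_null (by rw [decomp, decomp (fderiv ℝ v _), ht, hx])
      (by rw [decomp, decomp (fderiv ℝ v _), ht, hx])
  have hSigma (x : ℝ) : fderiv ℝ u (0, x) = fderiv ℝ v (0, x) := by
    have hclosed : IsClosed {t : ℝ | fderiv ℝ u (t, x) = fderiv ℝ v (t, x)} :=
      isClosed_eq (by fun_prop) (by fun_prop)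
    have hsub : Ioi (0 : ℝ) ⊆ {t : ℝ | fderiv ℝ u (t, x) = fderiv ℝ v (t, x)} :=
      fun t ht => hE ⟨x, t⟩ ht
    exact hclosed.closure_subset_iff.2 hsub (by simp)
  have hall (p : ℝ × ℝ) : fderiv ℝ u p = fderiv ℝ v p := by
    obtain ⟨t, x⟩ := p
    rcases lt_or_ge 0 t with ht | ht
    · exact hE ⟨x, t⟩ ht
    · have step (σ : ℝ) (hσ : σ * σ = 1) :
          fderiv ℝ u (t, x) (1, σ) = fderiv ℝ v (t, x) (1, σ) := by
        have h1 := hu.fderiv_null_const hσ (x + σ * t) ht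
        have h2 := hv.fderiv_null_const hσ (x + σ * t) ht
        rw [add_sub_cancel_right] at h1 h2
        rw [h1, h2, hSigma]
      exact ext_null (step 1 (by norm_num)) (step (-1) (by norm_num))
  exact eq_of_fderiv_eq hdu hdv hall (-1, a) (hdata a (left_mem_Icc.2 hab.le))
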